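/- Let q be an odd prime power and let ε ∈ {1,-1} be such that q ≡ ε (mod 4). Then for every involution t of PGL_2(q) that does not lie in the subgroup PSL_2(q), the centralizer of t in PGL_2(q) is isomorphic to the dihedral group of order 2(q+ε). -/

import Mathlib

/-- `PGL₂(F)`: the quotient of `GL(2,F)` by its center. -/
abbrev PGL2 (F : Type*) [Field F] :=
  Matrix.GeneralLinearGroup (Fin 2) F ⧸ Subgroup.center (Matrix.GeneralLinearGroup (Fin 2) F)

/-- `PSL₂(F)`: the image of `SL(2,F)` in `PGL₂(F)` under the natural map. -/
def PSL2 (F : Type*) [Field F] : Subgroup (PGL2 F) :=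
  ((QuotientGroup.mk' (Subgroup.center (Matrix.GeneralLinearGroup (Fin 2) F))).comp
    Matrix.SpecialLinearGroup.toGL).range

/-- A group with a cyclic subgroup `T` of index two, all of whose elements outside `T` square to
the identity, is dihedral. -/
theorem nonempty_mulEquiv_dihedralGroup {G : Type*} [Group G] (T : Subgroup G) [IsCyclic T]
    (s : G) (hs : s ∉ T) (hsq : ∀ x ∉ T, x * x = 1) (hidx : ∀ x ∉ T, s * x ∈ T) :
    Nonempty (G ≃* DihedralGroup (Nat.card T)) := by
  obtain ⟨r, hr⟩ := IsCyclic.exists_generator (α := T)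
  let e : Multiplicative (ZMod (Nat.card T)) ≃* T := zmodMulEquivOfGenerator hr rfl
  let f : ZMod (Nat.card T) → G := fun i => e (Multiplicative.ofAdd i)
  have hfT (i) : f i ∈ T := (e _).2
  have hf_add (i j) : f (i + j) = f i * f j := by simp [f]
  have hf_neg (i) : f (-i) = (f i)⁻¹ := by simp [f]
  have hf_inj {i j} (h : f i = f j) : i = j :=
    Multiplicative.ofAdd.injective (e.injective (Subtype.ext h))
  have hf_surj {x} (hx : x ∈ T) : ∃ i, f i = x :=
    ⟨Multiplicative.toAdd (e.symm ⟨x, hx⟩), by simp [f]⟩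
  have hsf (i) : s * f i ∉ T := fun h => hs ((T.mul_mem_cancel_right (hfT i)).1 h)
  have hss : s * s = 1 := hsq s hs
  have hcomm (i) : f i * s = s * f (-i) := by
    have h := hsq _ (hsf i)
    have h' : f i * s * f i = s := by
      rw [← mul_left_cancel_iff (a := s), hss, ← h]; group
    rw [hf_neg, eq_mul_inv_iff_mul_eq, h']
  have hcomm' (i) (y : G) : f i * (s * y) = s * (f (-i) * y) := by
    rw [← mul_assoc, hcomm, mul_assoc]
  have hss' (y : G) : s * (s * y) = y := by rw [← mul_assoc, hss, one_mul]
  let φ : DihedralGroup (Nat.card T) →* G := MonoidHom.mk' (fun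
    | .r i => f i
    | .sr i => s * f i) (by
      rintro (i | i) (j | j)
      · simp [hf_add]
      · simp [hcomm', ← hf_add, sub_eq_neg_add]
      · simp [hf_add, mul_assoc]
      · simp [hcomm', hss', mul_assoc, ← hf_add, sub_eq_neg_add])
  refine ⟨(MulEquiv.ofBijective φ ⟨?_, ?_⟩).symm⟩
  · rintro (i | i) (j | j) h
    · exact congrArg _ (hf_inj h)
    · exact absurd (show s * f j ∈ T from (show f i = s * f j from h) ▸ hfT i) (hsf j)
    · exact absurd (show s * f i ∈ T from (show s * f i = f j from h) ▸ hfT j) (hsf i)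
    · exact congrArg _ (hf_inj (mul_left_cancel h))
  · intro x
    by_cases hx : x ∈ T
    · obtain ⟨i, rfl⟩ := hf_surj hx
      exact ⟨.r i, rfl⟩
    · obtain ⟨i, hi⟩ := hf_surj (hidx x hx)
      exact ⟨.sr i, by change s * f i = x; rw [hi, hss']⟩

/-- If a homomorphism to the units of a domain has kernel contained in the kernel of `π`, then
the range of `π` is cyclic. -/
theorem MonoidHom.isCyclic_range_of_ker_le_of_units {C P E : Type*} [Group C] [Finite C] [Group P]
    [CommRing E] [IsDomain E] (f : C →* Eˣ) (π : C →* P) (h : f.ker ≤ π.ker) :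
    IsCyclic π.range := by
  have : IsCyclic (C ⧸ f.ker) :=
    isCyclic_of_injective_ringHom ((Units.coeHom E).comp (QuotientGroup.kerLift f))
      (Units.val_injective.comp (QuotientGroup.kerLift_injective f))
  refine isCyclic_of_surjective (QuotientGroup.lift f.ker π.rangeRestrict fun x hx => ?_) ?_
  · simpa [Subtype.ext_iff] using h hx
  · exact QuotientGroup.lift_surjective_of_surjective _ _ π.rangeRestrict_surjective _

section Matrices

open Matrix

variable {F : Type*} [Field F]

theorem PGL2.mk_eq_mk_iff {g h : GL (Fin 2) F} :
    (g : PGL2 F) = h ↔ ∃ c : F, c • g.val = h.val := by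
  rw [QuotientGroup.eq, Matrix.GeneralLinearGroup.mem_center_iff_val_mem_range_scalar]
  refine exists_congr fun c => ?_
  rw [Units.val_mul, ← Units.mul_right_inj g, Units.mul_inv_cancel_left, Matrix.scalar_apply,
    ← Matrix.smul_one_eq_diagonal, mul_smul_comm, mul_one]

theorem Matrix.trace_eq_zero_of_mul_self_eq_smul_one {g : Matrix (Fin 2) (Fin 2) F} {c : F}
    (hg : g * g = c • 1) (hns : ∀ x : F, g ≠ x • 1) : g.trace = 0 := by
  have h00 := congr_fun₂ hg 0 0
  have h01 := congr_fun₂ hg 0 1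
  have h10 := congr_fun₂ hg 1 0
  have h11 := congr_fun₂ hg 1 1
  simp [Matrix.mul_apply, Fin.sum_univ_two] at h00 h01 h10 h11
  by_contra ht
  rw [Matrix.trace_fin_two] at ht
  refine hns (g 0 0) ?_
  ext i j
  fin_cases i <;> fin_cases j <;> simp <;> apply mul_left_cancel₀ ht
  · linear_combination h01
  · linear_combination h10
  · linear_combination h11 - h00

theorem Matrix.mul_self_of_trace_eq_zero {g : Matrix (Fin 2) (Fin 2) F} (hg : g.trace = 0) :
    g * g = (-g.det) • 1 := by
  rw [Matrix.trace_fin_two] at hg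
  ext i j
  fin_cases i <;> fin_cases j <;> simp [Matrix.mul_apply, Fin.sum_univ_two, Matrix.det_fin_two]
  · linear_combination g 0 0 * hg
  · linear_combination g 0 1 * hg
  · linear_combination g 1 0 * hg
  · linear_combination g 1 1 * hg

/-- A matrix commuting with an invertible traceless `2 × 2` matrix `g` is a combination of `1`
and `g`. -/
theorem Matrix.eq_smul_one_add_smul_of_commute (h2 : (2 : F) ≠ 0)
    {g M : Matrix (Fin 2) (Fin 2) F} (hg : g.trace = 0) (hdet : g.det ≠ 0) (hM : M * g = g * M) :
    M = (M.trace / 2) • 1 + ((M * g).trace / (2 * -g.det)) • g := by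
  have h00 := congr_fun₂ hM 0 0
  have h01 := congr_fun₂ hM 0 1
  have h10 := congr_fun₂ hM 1 0
  have h11 := congr_fun₂ hM 1 1
  have hd : g.det = g 0 0 * g 1 1 - g 0 1 * g 1 0 := Matrix.det_fin_two g
  rw [Matrix.trace_fin_two] at hg
  have hg' : g 1 1 = - g 0 0 := by linear_combination hg
  simp only [Matrix.mul_apply, Fin.sum_univ_two, hg'] at h00 h01 h10 h11 hd
  ext i j
  fin_cases i <;> fin_cases j <;>
    simp [Matrix.trace_fin_two, Matrix.mul_apply, Fin.sum_univ_two, hg'] <;> field_simp <;>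
    rw [hd]
  · linear_combination -g 1 0 * h01 - g 0 0 * h00
  · linear_combination g 0 0 * h01 - g 0 1 * h00
  · linear_combination -g 0 0 * h10 + g 1 0 * h00
  · linear_combination g 1 0 * h01 + g 0 0 * h00

/-- Every traceless `2 × 2` matrix anticommutes with some invertible matrix. -/
theorem Matrix.exists_anticommute {g : Matrix (Fin 2) (Fin 2) F} (hg : g.trace = 0) :
    ∃ s : GL (Fin 2) F, s.val * g = -(g * s.val) := by
  rw [Matrix.trace_fin_two] at hg
  have hg' : g 1 1 = - g 0 0 := by linear_combination hg
  suffices ∃ u v w : F, u * u + v * w ≠ 0 ∧ 2 * g 0 0 * u + g 0 1 * w + g 1 0 * v = 0 by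
    obtain ⟨u, v, w, h, h'⟩ := this
    refine ⟨Matrix.GeneralLinearGroup.mkOfDetNeZero !![u, v; w, -u] ?_, ?_⟩
    · rw [Matrix.det_fin_two_of]
      contrapose! h
      linear_combination -h
    · ext i j
      fin_cases i <;> fin_cases j <;>
        simp [Matrix.GeneralLinearGroup.mkOfDetNeZero, Matrix.mul_apply, Fin.sum_univ_two, hg']
      · linear_combination h'
      · ring
      · ring
      · linear_combination h'
  by_cases hy : g 0 1 = 0
  · by_cases hz : g 1 0 = 0
    · exact ⟨0, 1, 1, by simp, by simp [hy, hz]⟩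
    · exact ⟨g 1 0, -2 * g 0 0, 0, by simpa using hz, by ring⟩
  · exact ⟨g 0 1, 0, -2 * g 0 0, by simpa using hy, by ring⟩

/-- Matrices anticommuting with an invertible matrix are traceless. -/
theorem Matrix.trace_eq_zero_of_anticommute (h2 : (2 : F) ≠ 0) {M : Matrix (Fin 2) (Fin 2) F}
    {g : GL (Fin 2) F} (h : M * g.val = -(g.val * M)) : M.trace = 0 := by
  have h1 : M = -(g.val * M * (g⁻¹).val) := by
    rw [← neg_mul, ← h, mul_assoc, ← Units.val_mul]; simp
  have h3 := congrArg Matrix.trace h1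
  rw [Matrix.trace_neg, Matrix.trace_mul_comm, ← mul_assoc, ← Units.val_mul] at h3
  simp at h3
  have : (2 : F) * M.trace = 0 := by linear_combination h3
  simpa [h2] using this

theorem Matrix.smul_one_add_smul_mul {g : Matrix (Fin 2) (Fin 2) F} (hg : g.trace = 0)
    (x y x' y' : F) : (x • 1 + y • g) * (x' • 1 + y' • g) =
      (x * x' + -g.det * (y * y')) • 1 + (x * y' + y * x') • g := by
  simp only [add_mul, mul_add, smul_mul_smul_comm, Matrix.mul_self_of_trace_eq_zero hg, one_mul,
    mul_one, add_smul, smul_smul]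
  rw [mul_comm (y * y')]
  abel

theorem Matrix.trace_smul_one_add_smul {g : Matrix (Fin 2) (Fin 2) F} (hg : g.trace = 0)
    (x y : F) : (x • 1 + y • g).trace = x * 2 := by
  simp [hg]

theorem Matrix.trace_smul_one_add_smul_mul_self {g : Matrix (Fin 2) (Fin 2) F} (hg : g.trace = 0)
    (x y : F) : ((x • 1 + y • g) * g).trace = y * (2 * -g.det) := by
  simp [add_mul, Matrix.mul_self_of_trace_eq_zero hg, hg, mul_comm]

theorem Matrix.det_smul_one_add_smul {g : Matrix (Fin 2) (Fin 2) F} (hg : g.trace = 0) (x y : F) :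
    (x • 1 + y • g).det = x ^ 2 + y ^ 2 * g.det := by
  rw [Matrix.trace_fin_two] at hg
  simp [Matrix.det_fin_two]
  linear_combination x * y * hg

theorem Matrix.ne_smul_one_of_trace_eq_zero (h2 : (2 : F) ≠ 0) {g : GL (Fin 2) F}
    (hg : g.val.trace = 0) (x : F) : g.val ≠ x • 1 := by
  intro h
  have hx : x = 0 := by simpa [h, h2] using hg
  rw [hx, zero_smul] at h
  exact g.ne_zero h

/-- For `g` traceless and `b ^ 2 = -det g`, the eigenvalue character on the centralizer of `g`
sending `x + y g` to `x + y b`. -/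
noncomputable def eigenvalueHom (h2 : (2 : F) ≠ 0) {g : GL (Fin 2) F} (hg : g.val.trace = 0)
    {E : Type*} [Field E] [Algebra F E] (b : E) (hb : b ^ 2 = algebraMap F E (-g.val.det)) :
    Subgroup.centralizer {g} →* E where
  toFun M := algebraMap F E (M.val.val.trace / 2) +
    algebraMap F E ((M.val.val * g.val).trace / (2 * -g.val.det)) * b
  map_one' := by simp [h2, hg]
  map_mul' M N := by
    have hdet : 2 * -g.val.det ≠ 0 := mul_ne_zero h2 (neg_ne_zero.2 g.det_ne_zero)
    have key (M : Subgroup.centralizer {g}) : ∃ x y : F, M.val.val = x • 1 + y • g.val :=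
      ⟨_, _, Matrix.eq_smul_one_add_smul_of_commute h2 hg g.det_ne_zero
        (congrArg Units.val (Subgroup.mem_centralizer_singleton_iff.1 M.2))⟩
    obtain ⟨x, y, hM⟩ := key M
    obtain ⟨x', y', hN⟩ := key N
    simp only [Subgroup.coe_mul, Units.val_mul, hM, hN, Matrix.smul_one_add_smul_mul hg,
      Matrix.trace_smul_one_add_smul hg, Matrix.trace_smul_one_add_smul_mul_self hg,
      mul_div_cancel_right₀ _ h2, mul_div_cancel_right₀ _ hdet, map_add, map_mul, ← hb]
    ring

/-- The image in `PGL₂(F)` of the centralizer of `g` in `GL₂(F)`. -/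
def projCentralizer (g : GL (Fin 2) F) : Subgroup (PGL2 F) :=
  ((QuotientGroup.mk' (Subgroup.center (GL (Fin 2) F))).comp
    (Subgroup.centralizer {g}).subtype).range

theorem mk_mem_projCentralizer {g h : GL (Fin 2) F} :
    (h : PGL2 F) ∈ projCentralizer g ↔ h.val * g.val = g.val * h.val := by
  constructor
  · rintro ⟨⟨k, hk⟩, hkh⟩
    obtain ⟨c, hc⟩ := PGL2.mk_eq_mk_iff.1 (show (k : PGL2 F) = h from hkh)
    rw [← hc, smul_mul_assoc, mul_smul_comm, ← Units.val_mul, ← Units.val_mul,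
      Subgroup.mem_centralizer_singleton_iff.1 hk]
  · intro h'
    exact ⟨⟨h, Subgroup.mem_centralizer_singleton_iff.2 (Units.ext h')⟩, rfl⟩

theorem isCyclic_projCentralizer [Finite F] (h2 : (2 : F) ≠ 0) {g : GL (Fin 2) F}
    (hg : g.val.trace = 0) : IsCyclic (projCentralizer g) := by
  obtain ⟨b, hb⟩ := IsAlgClosed.exists_pow_nat_eq
    (algebraMap F (AlgebraicClosure F) (-g.val.det)) two_pos
  have hb' : (-b) ^ 2 = algebraMap F (AlgebraicClosure F) (-g.val.det) := by rw [neg_sq, hb]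
  have hdet : -g.val.det ≠ 0 := neg_ne_zero.2 g.det_ne_zero
  have hb0 : b ≠ 0 := by
    rintro rfl
    exact hdet ((map_eq_zero (algebraMap F (AlgebraicClosure F))).1 (by rw [← hb]; simp))
  refine MonoidHom.isCyclic_range_of_ker_le_of_units
    ((eigenvalueHom h2 hg b hb).toHomUnits / (eigenvalueHom h2 hg (-b) hb').toHomUnits) _ ?_
  intro M hM
  rw [MonoidHom.mem_ker, MonoidHom.div_apply, div_eq_one, Units.ext_iff] at hM
  simp only [MonoidHom.coe_toHomUnits, eigenvalueHom, MonoidHom.coe_mk, OneHom.coe_mk,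
    add_right_inj] at hM
  have h2' : (2 : AlgebraicClosure F) ≠ 0 := by
    rw [← map_ofNat (algebraMap F (AlgebraicClosure F)) 2]
    exact (map_ne_zero _).2 h2
  have h0 : (M.val.val * g.val).trace / (2 * -g.val.det) = 0 := by
    refine (map_eq_zero (algebraMap F (AlgebraicClosure F))).1 ?_
    refine mul_left_cancel₀ h2' (mul_right_cancel₀ hb0 ?_)
    linear_combination hM
  have hMs := Matrix.eq_smul_one_add_smul_of_commute h2 hg g.det_ne_zero
    (congrArg Units.val (Subgroup.mem_centralizer_singleton_iff.1 M.2))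
  rw [h0, zero_smul, add_zero] at hMs
  change (M.val : PGL2 F) = ((1 : GL (Fin 2) F) : PGL2 F)
  exact (PGL2.mk_eq_mk_iff.2 ⟨_, hMs.symm⟩).symm

/-- The elements of `projCentralizer g` are the classes of `1` and of the `x + g` with
`x ^ 2 ≠ -det g`. -/
theorem card_projCentralizer [Fintype F] [DecidableEq F] (h2 : (2 : F) ≠ 0) {g : GL (Fin 2) F}
    (hg : g.val.trace = 0) :
    (Nat.card (projCentralizer g) : ℤ) = Fintype.card F - quadraticChar F (-g.val.det) := by
  have hdet (x : {x : F // ¬ x ^ 2 = -g.val.det}) : (x.val • 1 + (1 : F) • g.val).det ≠ 0 := by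
    rw [Matrix.det_smul_one_add_smul hg]
    intro h
    exact x.2 (by linear_combination h)
  let u (x : {x : F // ¬ x ^ 2 = -g.val.det}) : GL (Fin 2) F :=
    Matrix.GeneralLinearGroup.mkOfDetNeZero _ (hdet x)
  have hu (x) : (u x).val = x.val • 1 + (1 : F) • g.val := rfl
  have hmem (x) : (u x : PGL2 F) ∈ projCentralizer g := by
    rw [mk_mem_projCentralizer, hu]
    simp [add_mul, mul_add]
  let f : Option {x : F // ¬ x ^ 2 = -g.val.det} → projCentralizer g := fun o =>
    o.elim 1 fun x => ⟨u x, hmem x⟩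
  have hinj (c c' d d' : F) (h : c • (1 : Matrix (Fin 2) (Fin 2) F) + d • g.val =
      c' • 1 + d' • g.val) : c = c' ∧ d = d' := by
    constructor
    · simpa [hg, h2] using congrArg Matrix.trace h
    · have := congrArg (fun M => (M * g.val).trace) h
      simpa [Matrix.trace_smul_one_add_smul_mul_self hg, h2, g.det_ne_zero] using this
  have hne (x) : (u x : PGL2 F) ≠ 1 := by
    intro h
    obtain ⟨c, hc⟩ := PGL2.mk_eq_mk_iff.1 (show ((1 : GL (Fin 2) F) : PGL2 F) = u x from h.symm)
    rw [hu] at hc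
    have := hinj c x 0 1 (by simpa using hc)
    exact zero_ne_one this.2
  have hf : Function.Bijective f := by
    constructor
    · rintro (_ | x) (_ | y) h
      · rfl
      · exact absurd (congrArg Subtype.val h).symm (hne y)
      · exact absurd (congrArg Subtype.val h) (hne x)
      · obtain ⟨c, hc⟩ := PGL2.mk_eq_mk_iff.1 (show (u x : PGL2 F) = u y from
          congrArg Subtype.val h)
        rw [hu, hu, smul_add, smul_smul, smul_smul] at hc
        obtain ⟨h1, h3⟩ := hinj _ _ _ _ hc
        rw [mul_one] at h3
        rw [h3, one_mul] at h1
        exact congrArg some (Subtype.ext h1)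
    · rintro ⟨⟨M⟩, hM⟩
      have hMg := mk_mem_projCentralizer.1 hM
      have hMs := Matrix.eq_smul_one_add_smul_of_commute h2 hg g.det_ne_zero hMg
      set x := M.val.trace / 2
      set y := (M.val * g.val).trace / (2 * -g.val.det)
      by_cases hy : y = 0
      · refine ⟨none, Subtype.ext (PGL2.mk_eq_mk_iff (g := 1) (h := M).2 ⟨x, ?_⟩)⟩
        rw [hMs, hy, zero_smul, add_zero, Units.val_one]
      · refine ⟨some ⟨x / y, fun h => M.det_ne_zero ?_⟩,
          Subtype.ext (PGL2.mk_eq_mk_iff (g := u _) (h := M).2 ⟨y, ?_⟩)⟩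
        · rw [hMs, Matrix.det_smul_one_add_smul hg]
          field_simp at h
          linear_combination h
        · refine Eq.trans ?_ hMs.symm
          rw [hu, smul_add, smul_smul, smul_smul, mul_one, mul_div_cancel₀ _ hy]
  rw [← Nat.card_congr (Equiv.ofBijective f hf), Nat.card_eq_fintype_card, Fintype.card_option,
    Fintype.card_subtype_compl]
  have h := quadraticChar_card_sqrts (F := F) (mt (fun h => ?_) h2) (-g.val.det)
  · rw [Set.toFinset_card] at h
    have hle := Fintype.card_subtype_le (fun x : F => x ^ 2 = -g.val.det)
    have : Fintype.card {x : F | x ^ 2 = -g.val.det} = Fintype.card {x : F // x ^ 2 = -g.val.det} :=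
      Fintype.card_congr (Equiv.refl _)
    push_cast [Nat.cast_sub hle]
    omega
  · have := ringChar.Nat.cast_ringChar (R := F)
    rw [h] at this
    exact_mod_cast this

theorem Matrix.mul_comm_or_anticomm_of_smul_eq {g h : GL (Fin 2) F} {c : F}
    (hc : c • (h.val * g.val) = g.val * h.val) :
    h.val * g.val = g.val * h.val ∨ h.val * g.val = -(g.val * h.val) := by
  have hdet := congrArg Matrix.det hc
  rw [Matrix.det_smul, Fintype.card_fin, Matrix.det_mul, Matrix.det_mul,
    mul_comm g.val.det, mul_eq_right₀ (mul_ne_zero h.det_ne_zero g.det_ne_zero),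
    sq_eq_one_iff] at hdet
  rcases hdet with rfl | rfl
  · exact .inl (by simpa using hc)
  · exact .inr (by simpa using congrArg Neg.neg hc)

theorem Matrix.trace_eq_zero_of_orderOf_eq_two {g : GL (Fin 2) F}
    (hg : orderOf (g : PGL2 F) = 2) : g.val.trace = 0 := by
  obtain ⟨h1, h2⟩ := orderOf_eq_prime_iff.1 hg
  obtain ⟨c, hc⟩ := PGL2.mk_eq_mk_iff.1
    (show ((1 : GL (Fin 2) F) : PGL2 F) = (g * g : GL (Fin 2) F) by
      rw [QuotientGroup.mk_mul, ← sq, h1]; rfl)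
  refine Matrix.trace_eq_zero_of_mul_self_eq_smul_one (c := c) (by simpa using hc.symm) ?_
  intro x hx
  exact h2 (PGL2.mk_eq_mk_iff (g := 1) (h := g).2 ⟨x, by simpa using hx.symm⟩).symm

theorem PGL2.mk_mem_PSL2_of_isSquare_det {g : GL (Fin 2) F} (hg : IsSquare g.val.det) :
    (g : PGL2 F) ∈ PSL2 F := by
  obtain ⟨r, hr⟩ := hg
  have hr0 : r ≠ 0 := by
    rintro rfl
    exact g.det_ne_zero (by simpa using hr)
  refine ⟨⟨r⁻¹ • g.val, ?_⟩, PGL2.mk_eq_mk_iff.2 ⟨r, ?_⟩⟩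
  · rw [Matrix.det_smul, hr, Fintype.card_fin]
    field_simp
  · exact smul_inv_smul₀ hr0 g.val

/-- The centralizer in `PGL₂(F)` of the class of a traceless matrix `g` is dihedral, with cyclic
part the image of the centralizer of `g` in `GL₂(F)`. -/
theorem nonempty_centralizer_mulEquiv_dihedralGroup [Finite F] (h2 : (2 : F) ≠ 0)
    {g : GL (Fin 2) F} (hg : g.val.trace = 0) :
    Nonempty (Subgroup.centralizer {(g : PGL2 F)} ≃*
      DihedralGroup (Nat.card (projCentralizer g))) := by
  have hmem {h : GL (Fin 2) F} : (h : PGL2 F) ∈ Subgroup.centralizer {(g : PGL2 F)} ↔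
      h.val * g.val = g.val * h.val ∨ h.val * g.val = -(g.val * h.val) := by
    rw [Subgroup.mem_centralizer_singleton_iff, ← QuotientGroup.mk_mul, ← QuotientGroup.mk_mul,
      PGL2.mk_eq_mk_iff]
    refine ⟨fun ⟨c, hc⟩ => Matrix.mul_comm_or_anticomm_of_smul_eq (c := c) hc, ?_⟩
    rintro (h | h)
    · exact ⟨1, by simp [h]⟩
    · exact ⟨-1, by simp [h]⟩
  have hle : projCentralizer g ≤ Subgroup.centralizer {(g : PGL2 F)} := by
    rintro ⟨h⟩ hh
    exact hmem.2 (.inl (mk_mem_projCentralizer.1 hh))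
  have hanti {h : GL (Fin 2) F} (h1 : (h : PGL2 F) ∈ Subgroup.centralizer {(g : PGL2 F)})
      (h3 : (h : PGL2 F) ∉ projCentralizer g) : h.val * g.val = -(g.val * h.val) :=
    (hmem.1 h1).resolve_left (mt mk_mem_projCentralizer.2 h3)
  obtain ⟨s, hs⟩ := Matrix.exists_anticommute hg
  have : IsCyclic (projCentralizer g) := isCyclic_projCentralizer h2 hg
  let e := Subgroup.subgroupOfEquivOfLe hle
  have : IsCyclic ((projCentralizer g).subgroupOf (Subgroup.centralizer {(g : PGL2 F)})) :=
    e.isCyclic.2 this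
  rw [← Nat.card_congr e.toEquiv]
  refine nonempty_mulEquiv_dihedralGroup _ ⟨(s : PGL2 F), hmem.2 (.inr hs)⟩ ?_ ?_ ?_
  · rw [Subgroup.mem_subgroupOf, mk_mem_projCentralizer, hs, neg_eq_iff_add_eq_zero, ← two_smul F,
      smul_eq_zero_iff_right h2, ← Units.val_mul]
    exact Units.ne_zero _
  · rintro ⟨⟨h⟩, hh⟩ hhT
    have ht := Matrix.trace_eq_zero_of_anticommute h2 (hanti hh hhT)
    refine Subtype.ext (PGL2.mk_eq_mk_iff (g := 1) (h := h * h).2 ⟨-h.val.det, ?_⟩).symm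
    rw [Units.val_mul, Matrix.mul_self_of_trace_eq_zero ht, Units.val_one]
  · rintro ⟨⟨h⟩, hh⟩ hhT
    refine mk_mem_projCentralizer (h := s * h).2 ?_
    rw [Units.val_mul, mul_assoc, hanti hh hhT, mul_neg, ← mul_assoc, hs, neg_mul, neg_neg,
      mul_assoc]

end Matrices

/-- For an odd prime power `q` with `q ≡ ε (mod 4)`, `ε = ±1`, the centralizer in
`PGL₂(q)` of any involution `t` not lying in `PSL₂(q)` is isomorphic to the dihedral
group of order `2(q+ε)`. -/
theorem centralizer_outer_involution_PGL2 (q : ℕ) (hq : IsPrimePow q) (hodd : Odd q)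
    (ε : ℤ) (hε : ε = 1 ∨ ε = -1) (hmod : (q : ℤ) ≡ ε [ZMOD 4])
    (F : Type*) [Field F] [Fintype F] (hF : Fintype.card F = q)
    (t : PGL2 F) (ht : orderOf t = 2) (htn : t ∉ PSL2 F) :
    ∃ m : ℕ, (m : ℤ) = (q : ℤ) + ε ∧
      Nonempty (Subgroup.centralizer {t} ≃* DihedralGroup m) := by
  classical
  obtain ⟨g, rfl⟩ := QuotientGroup.mk_surjective t
  subst hF
  have hchar : ringChar F ≠ 2 := fun h =>
    Nat.not_even_iff_odd.2 hodd (Nat.even_iff.2 (FiniteField.even_card_iff_char_two.1 h))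
  have h2 : (2 : F) ≠ 0 := Ring.two_ne_zero hchar
  have hg := Matrix.trace_eq_zero_of_orderOf_eq_two ht
  refine ⟨_, ?_, nonempty_centralizer_mulEquiv_dihedralGroup h2 hg⟩
  rw [card_projCentralizer h2 hg, ← neg_one_mul, map_mul, quadraticChar_neg_one hchar,
    quadraticChar_neg_one_iff_not_isSquare.2 (mt PGL2.mk_mem_PSL2_of_isSquare_det htn)]
  rcases hε with rfl | rfl
  · rw [ZMod.χ₄_nat_one_mod_four (by have := hmod.eq; omega)]
    ring
  · rw [ZMod.χ₄_nat_three_mod_four (by have := hmod.eq; omega)]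
    ring
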